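/- Let p be a probability distribution on the positive integers with p(1) < 1 and μ := Σ_{k≥1} p(k)·log k < ∞ (so 0 < μ < ∞). Fix ε ∈ (0,1). Then for every sequence of integers (k_n) with k_n > (1+ε)·(3/(2μ))·log n for all n, lim_{n→∞} ‖Q_{n,p}^{k_n} − U_n‖_TV = 0; and for every sequence of nonnegative integers (k_n) with k_n < (1−ε)·(3/(2μ))·log n for all n, lim_{n→∞} ‖Q_{n,p}^{k_n} − U_n‖_TV = 1. -/

import Mathlib

open Filter MeasureTheory
open scoped BigOperators NNReal ENNReal

noncomputable section

/-- The value of `σ⁻¹` at position `i` (0-indexed), as a natural number; `0` out of range. -/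
def invAt (n : ℕ) (σ : Equiv.Perm (Fin n)) (i : ℕ) : ℕ :=
  if h : i < n then ((σ⁻¹ ⟨i, h⟩ : Fin n) : ℕ) else 0

/-- The number of rising sequences of a permutation: one plus the number of descents
of its inverse. -/
def rSeq (n : ℕ) (σ : Equiv.Perm (Fin n)) : ℕ :=
  1 + ((Finset.range (n - 1)).filter fun i => invAt n σ (i + 1) < invAt n σ i).card

/-- The `m`-shuffle distribution on `S_n`:  `Q_{n,m}(σ) = m^{-n} C(n + m - r(σ), n)`. -/
def Qs (n m : ℕ) (σ : Equiv.Perm (Fin n)) : ℝ :=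
  ((m : ℝ) ^ n)⁻¹ * (Nat.choose (n + m - rSeq n σ) n : ℝ)

/-- The uniform distribution on `S_n`. -/
def Us (n : ℕ) (_ : Equiv.Perm (Fin n)) : ℝ := (n.factorial : ℝ)⁻¹

/-- Total variation distance between two probability distributions on `S_n`. -/
def tv (n : ℕ) (μ ν : Equiv.Perm (Fin n) → ℝ) : ℝ :=
  (1 / 2) * ∑ σ : Equiv.Perm (Fin n), |μ σ - ν σ|

/-- Convolution of two distributions on `S_n`. -/
def convol (n : ℕ) (μ ν : Equiv.Perm (Fin n) → ℝ) : Equiv.Perm (Fin n) → ℝ :=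
  fun σ => ∑ τ : Equiv.Perm (Fin n), μ (σ * τ⁻¹) * ν τ

/-- `k`-fold convolution power; the `0`-th power is the point mass at the identity. -/
def iterConv (n : ℕ) (μ : Equiv.Perm (Fin n) → ℝ) : ℕ → Equiv.Perm (Fin n) → ℝ
  | 0 => fun σ => if σ = 1 then 1 else 0
  | k + 1 => convol n μ (iterConv n μ k)

/-- `Ψ(x) = (2π)^{-1/2} ∫_{-x/(4√3)}^{x/(4√3)} e^{-t²/2} dt`. -/
def Psi (x : ℝ) : ℝ :=
  (Real.sqrt (2 * Real.pi))⁻¹ *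
    ∫ t in (-(x / (4 * Real.sqrt 3)))..(x / (4 * Real.sqrt 3)), Real.exp (-t ^ 2 / 2)

/-- The `p`-shuffle distribution on `S_n` for a probability `p` on the positive integers. -/
def Qp (n : ℕ) (p : ℕ → ℝ) (σ : Equiv.Perm (Fin n)) : ℝ := ∑' m : ℕ, p m * Qs n m σ

/-- A word `w` is sorted by `σ⁻¹` exactly when it weakly increases along `σ⁻¹`, strictly at each
descent of `σ⁻¹`. -/
lemma sort_eq_inv_iff {n m : ℕ} (σ : Equiv.Perm (Fin (n + 1))) (w : Fin (n + 1) → Fin m) :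
    Tuple.sort w = σ⁻¹ ↔ ∀ i : Fin n,
      (w (σ⁻¹ i.castSucc) : ℕ) + (if σ⁻¹ i.succ < σ⁻¹ i.castSucc then 1 else 0) ≤
        w (σ⁻¹ i.succ) := by
  rw [eq_comm, Tuple.eq_sort_iff', Fin.strictMono_iff_lt_succ]
  refine forall_congr' fun i => ?_
  have hne : σ⁻¹ i.succ ≠ σ⁻¹ i.castSucc := fun h => by
    simpa [Fin.ext_iff] using σ⁻¹.injective h
  change toLex (w (σ⁻¹ i.castSucc), σ⁻¹ i.castSucc) < toLex (w (σ⁻¹ i.succ), σ⁻¹ i.succ) ↔ _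
  rw [Prod.Lex.toLex_lt_toLex]
  simp only [Fin.lt_def, Fin.ext_iff, ne_eq] at *
  split_ifs <;> omega

lemma invAt_val {n : ℕ} (σ : Equiv.Perm (Fin n)) (i : Fin n) : invAt n σ i = (σ⁻¹ i : ℕ) := by
  simp [invAt]

/-- The number of descents of `σ⁻¹` among the first `i` positions. -/
def descCount (n : ℕ) (σ : Equiv.Perm (Fin n)) (i : ℕ) : ℕ :=
  ((Finset.range i).filter fun j => invAt n σ (j + 1) < invAt n σ j).card

lemma descCount_succ (n : ℕ) (σ : Equiv.Perm (Fin n)) (i : ℕ) :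
    descCount n σ (i + 1) =
      descCount n σ i + if invAt n σ (i + 1) < invAt n σ i then 1 else 0 := by
  unfold descCount
  rw [Finset.range_add_one, Finset.filter_insert]
  split_ifs
  · rw [Finset.card_insert_of_notMem (by simp)]
  · simp

lemma descCount_le (n : ℕ) (σ : Equiv.Perm (Fin n)) (i : ℕ) : descCount n σ i ≤ i :=
  (Finset.card_filter_le _ _).trans_eq (Finset.card_range i)

lemma rSeq_eq (n : ℕ) (σ : Equiv.Perm (Fin n)) : rSeq n σ = 1 + descCount n σ (n - 1) := rfl

lemma card_orderEmb_fin (n N : ℕ) : Nat.card (Fin n ↪o Fin N) = N.choose n := by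
  rw [Nat.card_congr Set.powersetCard.ofFinEmbEquiv, Set.powersetCard.card]
  simp

lemma le_orderEmb_fin {n N : ℕ} (h : Fin (n + 1) ↪o Fin N) (i : Fin (n + 1)) :
    (i : ℕ) ≤ h i := by
  induction i using Fin.induction with
  | zero => simp
  | succ i ih =>
    have h1 : h i.castSucc < h i.succ := h.strictMono Fin.castSucc_lt_succ
    simp only [Fin.val_succ, Fin.val_castSucc, Fin.lt_def] at *
    omega

lemma descCount_le_of_sort_eq {n m : ℕ} {σ : Equiv.Perm (Fin (n + 1))} {w : Fin (n + 1) → Fin m}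
    (hw : Tuple.sort w = σ⁻¹) (i : Fin (n + 1)) : descCount (n + 1) σ i ≤ w (σ⁻¹ i) := by
  rw [sort_eq_inv_iff] at hw
  induction i using Fin.induction with
  | zero => simp [descCount]
  | succ i ih =>
    have h1 := hw i
    have h2 := descCount_succ (n + 1) σ i
    have h3 := invAt_val σ i.succ
    have h4 := invAt_val σ i.castSucc
    simp only [Fin.val_succ, Fin.val_castSucc, Fin.lt_def] at *
    rw [h3, h4] at h2
    split_ifs at h1 h2 <;> omega

/-- Words sorted by `σ⁻¹` correspond to strictly increasing sequences. -/
def sortedWordEquiv {n m : ℕ} (σ : Equiv.Perm (Fin (n + 1))) :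
    {w : Fin (n + 1) → Fin m // Tuple.sort w = σ⁻¹} ≃
      (Fin (n + 1) ↪o Fin (n + 1 + m - rSeq (n + 1) σ)) where
  toFun w := OrderEmbedding.ofStrictMono
    (fun i => ⟨w.1 (σ⁻¹ i) + i - descCount (n + 1) σ i, by
      have hw := (sort_eq_inv_iff σ w.1).1 w.2
      have key : Monotone fun i : Fin (n + 1) =>
          (w.1 (σ⁻¹ i) : ℤ) + i - descCount (n + 1) σ i := by
        rw [Fin.monotone_iff_le_succ]
        intro i
        have h1 := hw i
        have h2 := descCount_succ (n + 1) σ i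
        have h3 := invAt_val σ i.succ
        have h4 := invAt_val σ i.castSucc
        simp only [Fin.val_succ, Fin.val_castSucc, Fin.lt_def] at *
        rw [h3, h4] at h2
        split_ifs at h1 h2 <;> omega
      have := key (Fin.le_last i)
      have h1 := (w.1 (σ⁻¹ (Fin.last n))).2
      have h2 := descCount_le (n + 1) σ n
      have h3 := descCount_le (n + 1) σ i
      simp only [rSeq_eq, Fin.val_last, Nat.add_sub_cancel] at *
      omega⟩) (by
      have hw := (sort_eq_inv_iff σ w.1).1 w.2
      rw [Fin.strictMono_iff_lt_succ]
      intro i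
      have h1 := hw i
      have h2 := descCount_succ (n + 1) σ i
      have h3 := invAt_val σ i.succ
      have h4 := invAt_val σ i.castSucc
      have h5 := descCount_le (n + 1) σ i
      simp only [Fin.val_succ, Fin.val_castSucc, Fin.lt_def] at *
      rw [h3, h4] at h2
      split_ifs at h1 h2 <;> omega)
  invFun h := ⟨fun x => ⟨h (σ x) - σ x + descCount (n + 1) σ (σ x), by
      have key : Monotone fun i : Fin (n + 1) =>
          ((h i : ℕ) : ℤ) - i + descCount (n + 1) σ i := by
        rw [Fin.monotone_iff_le_succ]
        intro i
        have h1 : h i.castSucc < h i.succ := h.strictMono Fin.castSucc_lt_succ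
        have h2 := descCount_succ (n + 1) σ i
        simp only [Fin.val_succ, Fin.val_castSucc, Fin.lt_def] at *
        split_ifs at h2 <;> omega
      have h0 := key (Fin.le_last (σ x))
      have h1 := (h (Fin.last n)).2
      have h2 := descCount_le (n + 1) σ n
      have h3 := le_orderEmb_fin h (σ x)
      simp only [rSeq_eq, Fin.val_last, Nat.add_sub_cancel] at *
      omega⟩, by
      rw [sort_eq_inv_iff]
      intro i
      have hσ : ∀ x, σ (σ⁻¹ x) = x := σ.apply_symm_apply
      have h6 := le_orderEmb_fin h i.castSucc
      have h1 : h i.castSucc < h i.succ := h.strictMono Fin.castSucc_lt_succ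
      have h2 := descCount_succ (n + 1) σ i
      have h3 := invAt_val σ i.succ
      have h4 := invAt_val σ i.castSucc
      simp only [Fin.val_succ, Fin.val_castSucc, Fin.lt_def, hσ] at *
      rw [h3, h4] at h2
      split_ifs at h2 ⊢ <;> omega⟩
  left_inv w := by
    ext x
    have h1 := descCount_le (n + 1) σ (σ x)
    have h2 := descCount_le_of_sort_eq w.2 (σ x)
    simp only [Equiv.Perm.inv_def, Equiv.symm_apply_apply, OrderEmbedding.coe_ofStrictMono] at *
    omega
  right_inv h := by
    ext i
    have := le_orderEmb_fin h i
    simp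
    omega

lemma card_sort_eq_inv {n : ℕ} (hn : 0 < n) (m : ℕ) (σ : Equiv.Perm (Fin n)) :
    Nat.card {w : Fin n → Fin m // Tuple.sort w = σ⁻¹} = (n + m - rSeq n σ).choose n := by
  obtain ⟨n, rfl⟩ := Nat.exists_eq_succ_of_ne_zero hn.ne'
  rw [Nat.card_congr (sortedWordEquiv σ), card_orderEmb_fin]

lemma Qs_eq_sum {n : ℕ} (hn : 0 < n) (m : ℕ) (σ : Equiv.Perm (Fin n)) :
    Qs n m σ = ((m : ℝ) ^ n)⁻¹ *
      ∑ w : Fin n → Fin m, if Tuple.sort w = σ⁻¹ then (1 : ℝ) else 0 := by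
  rw [Qs, ← card_sort_eq_inv hn, Finset.sum_boole, Nat.card_eq_fintype_card, Fintype.card_subtype]

lemma Qs_nonneg (n m : ℕ) (σ : Equiv.Perm (Fin n)) : 0 ≤ Qs n m σ := by
  unfold Qs; positivity

lemma Qs_zero {n : ℕ} (hn : 0 < n) (σ : Equiv.Perm (Fin n)) : Qs n 0 σ = 0 := by
  simp [Qs, hn.ne']

lemma sum_Qs {n m : ℕ} (hn : 0 < n) (hm : 0 < m) : ∑ σ, Qs n m σ = 1 := by
  have hm' : (m : ℝ) ≠ 0 := by positivity
  simp_rw [Qs_eq_sum hn, ← Finset.mul_sum]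
  rw [Finset.sum_comm]
  have h : ∀ w : Fin n → Fin m,
      ∑ σ : Equiv.Perm (Fin n), (if Tuple.sort w = σ⁻¹ then (1 : ℝ) else 0) = 1 := by
    intro w
    simp_rw [← inv_eq_iff_eq_inv]
    simp
  simp [h, hm']

lemma sum_Qs_le_one {n : ℕ} (hn : 0 < n) (m : ℕ) : ∑ σ, Qs n m σ ≤ 1 := by
  rcases m.eq_zero_or_pos with rfl | hm
  · simp [Qs_zero hn]
  · exact (sum_Qs hn hm).le

lemma Qs_le_one {n : ℕ} (hn : 0 < n) (m : ℕ) (σ : Equiv.Perm (Fin n)) : Qs n m σ ≤ 1 :=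
  (Finset.single_le_sum (fun τ _ => Qs_nonneg n m τ) (Finset.mem_univ σ)).trans
    (sum_Qs_le_one hn m)

/-- Radix sort: sorting stably by the low digit and then by the high digit sorts the word. -/
lemma sort_finProdFinEquiv {n a b : ℕ} (u : Fin n → Fin a) (v : Fin n → Fin b) :
    Tuple.sort (fun x => finProdFinEquiv (u x, v x)) =
      Tuple.sort v * Tuple.sort (u ∘ Tuple.sort v) := by
  obtain ⟨hv, hv'⟩ := Tuple.eq_sort_iff.1 (rfl : Tuple.sort v = Tuple.sort v)
  obtain ⟨hu, hu'⟩ := Tuple.eq_sort_iff.1 (rfl : Tuple.sort (u ∘ Tuple.sort v) = _)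
  set s := Tuple.sort v
  set t := Tuple.sort (u ∘ s)
  symm
  rw [Tuple.eq_sort_iff]
  constructor
  · intro i j hij
    rcases hij.eq_or_lt with rfl | hij
    · rfl
    have h1 : u (s (t i)) ≤ u (s (t j)) := hu hij.le
    simp only [Function.comp_apply, Equiv.Perm.coe_mul, Fin.le_def, finProdFinEquiv_apply_val]
    rcases h1.eq_or_lt with h | h
    · have h2 : v (s (t i)) ≤ v (s (t j)) := hv (hu' i j hij h).le
      rw [h]
      exact Nat.add_le_add_right h2 _
    · have h3 : (u (s (t i)) : ℕ) + 1 ≤ u (s (t j)) := h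
      have h4 := (v (s (t i))).2
      nlinarith
  · intro i j hij h
    have h' := finProdFinEquiv.injective h
    rw [Prod.mk.injEq] at h'
    exact hv' _ _ (hu' i j hij h'.1) h'.2

lemma convol_Qs {n : ℕ} (hn : 0 < n) (a b : ℕ) :
    convol n (Qs n a) (Qs n b) = Qs n (a * b) := by
  funext σ
  have h1 : ∀ v : Fin n → Fin b, ∑ τ : Equiv.Perm (Fin n),
      (∑ u : Fin n → Fin a, if Tuple.sort u = (σ * τ⁻¹)⁻¹ then (1 : ℝ) else 0) *
        (if Tuple.sort v = τ⁻¹ then (1 : ℝ) else 0) =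
      ∑ u : Fin n → Fin a,
        if Tuple.sort (fun x => finProdFinEquiv (u x, v x)) = σ⁻¹ then (1 : ℝ) else 0 := by
    intro v
    simp_rw [← inv_eq_iff_eq_inv (a := Tuple.sort v), mul_ite, mul_one, mul_zero]
    rw [Finset.sum_ite_eq Finset.univ (Tuple.sort v)⁻¹, if_pos (Finset.mem_univ _)]
    refine (Fintype.sum_equiv ((Tuple.sort v).symm.arrowCongr (Equiv.refl (Fin a))) _ _ ?_).symm
    intro u
    rw [sort_finProdFinEquiv]
    have : ((Tuple.sort v).symm.arrowCongr (Equiv.refl (Fin a))) u = u ∘ Tuple.sort v := by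
      ext x; simp
    rw [this]
    congr 1
    rw [mul_inv_rev, inv_inv, eq_inv_mul_iff_mul_eq]
  have h2 : ∑ w : Fin n → Fin (a * b), (if Tuple.sort w = σ⁻¹ then (1 : ℝ) else 0) =
      ∑ v : Fin n → Fin b, ∑ u : Fin n → Fin a,
        if Tuple.sort (fun x => finProdFinEquiv (u x, v x)) = σ⁻¹ then (1 : ℝ) else 0 := by
    rw [Finset.sum_comm, ← Fintype.sum_prod_type']
    symm
    refine Fintype.sum_equiv ((Equiv.arrowProdEquivProdArrow (Fin n) (fun _ => Fin a)
      (fun _ => Fin b)).symm.trans (Equiv.arrowCongr (Equiv.refl _) finProdFinEquiv)) _ _ ?_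
    intro x
    rfl
  simp only [convol, Qs_eq_sum hn]
  rw [h2]
  simp_rw [← h1]
  rw [Finset.sum_comm, Finset.mul_sum]
  refine Finset.sum_congr rfl fun τ _ => ?_
  rw [← Finset.mul_sum]
  push_cast
  rw [mul_pow, mul_inv]
  ring

lemma Qs_one {n : ℕ} (hn : 0 < n) (σ : Equiv.Perm (Fin n)) :
    Qs n 1 σ = if σ = 1 then 1 else 0 := by
  have h : ∀ w : Fin n → Fin 1, Tuple.sort w = 1 := fun w =>
    Tuple.sort_eq_refl_iff_monotone.2 fun i j _ => (Subsingleton.elim (w i) (w j)).le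
  rw [Qs_eq_sum hn]
  simp [h, eq_comm]

/-- The centred descent indicator of `σ⁻¹` at position `i`. -/
def descSign {n : ℕ} (σ : Equiv.Perm (Fin (n + 1))) (i : Fin n) : ℝ :=
  (if σ⁻¹ i.succ < σ⁻¹ i.castSucc then 1 else 0) - 1 / 2

lemma rSeq_sub_eq_sum {n : ℕ} (σ : Equiv.Perm (Fin (n + 1))) :
    (rSeq (n + 1) σ : ℝ) - ((n + 1 : ℕ) + 1) / 2 = ∑ i, descSign σ i := by
  have h : (descCount (n + 1) σ n : ℝ) =
      ∑ i : Fin n, if σ⁻¹ i.succ < σ⁻¹ i.castSucc then (1 : ℝ) else 0 := by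
    rw [descCount, ← Finset.sum_boole, ← Fin.sum_univ_eq_sum_range
      (fun i => if invAt (n + 1) σ (i + 1) < invAt (n + 1) σ i then (1 : ℝ) else 0)]
    refine Finset.sum_congr rfl fun i _ => ?_
    have h3 := invAt_val σ i.succ
    have h4 := invAt_val σ i.castSucc
    simp only [Fin.val_succ, Fin.val_castSucc, Fin.lt_def] at *
    rw [h3, h4]
  simp only [descSign, Finset.sum_sub_distrib, ← h, rSeq_eq]
  simp
  ring

lemma descSign_swap_mul_self {n : ℕ} (σ : Equiv.Perm (Fin (n + 1))) (i : Fin n) :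
    descSign (Equiv.swap i.castSucc i.succ * σ) i = -descSign σ i := by
  have hne : σ⁻¹ i.succ ≠ σ⁻¹ i.castSucc := fun h => by
    simpa [Fin.ext_iff] using σ⁻¹.injective h
  simp only [descSign, mul_inv_rev, Equiv.swap_inv, Equiv.Perm.coe_mul, Function.comp_apply,
    Equiv.swap_apply_left, Equiv.swap_apply_right]
  rcases hne.lt_or_gt with h | h
  · rw [if_neg h.not_gt, if_pos h]; norm_num
  · rw [if_neg h.not_gt, if_pos h]; norm_num

lemma descSign_swap_mul_of_ne {n : ℕ} (σ : Equiv.Perm (Fin (n + 1))) {i j : Fin n}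
    (hij : (i : ℕ) + 1 < j ∨ (j : ℕ) + 1 < i) :
    descSign (Equiv.swap i.castSucc i.succ * σ) j = descSign σ j := by
  simp only [descSign, mul_inv_rev, Equiv.swap_inv, Equiv.Perm.coe_mul, Function.comp_apply]
  rw [Equiv.swap_apply_of_ne_of_ne (x := j.succ), Equiv.swap_apply_of_ne_of_ne (x := j.castSucc)]
  all_goals
    simp only [ne_eq, Fin.ext_iff, Fin.val_succ, Fin.val_castSucc]
    omega

lemma sum_descSign_mul_eq_zero {n : ℕ} {i j : Fin n}
    (hij : (i : ℕ) + 1 < j ∨ (j : ℕ) + 1 < i) :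
    ∑ σ : Equiv.Perm (Fin (n + 1)), descSign σ i * descSign σ j = 0 := by
  have h := Fintype.sum_equiv (Equiv.mulLeft (Equiv.swap i.castSucc i.succ))
    (fun σ : Equiv.Perm (Fin (n + 1)) => -(descSign σ i * descSign σ j))
    (fun σ => descSign σ i * descSign σ j) (fun σ => by
      rw [Equiv.coe_mulLeft, descSign_swap_mul_self, descSign_swap_mul_of_ne σ hij, neg_mul])
  rw [Finset.sum_neg_distrib] at h
  linarith

lemma descSign_mul_le {n : ℕ} (σ : Equiv.Perm (Fin (n + 1))) (i j : Fin n) :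
    descSign σ i * descSign σ j ≤ 1 / 4 := by
  unfold descSign
  split_ifs <;> norm_num

lemma sum_rSeq_sub_sq_le {n : ℕ} (hn : 0 < n) :
    ∑ σ : Equiv.Perm (Fin n), ((rSeq n σ : ℝ) - (n + 1) / 2) ^ 2 ≤ (n : ℝ) * n.factorial := by
  obtain ⟨n, rfl⟩ := Nat.exists_eq_succ_of_ne_zero hn.ne'
  have hcard : ∀ i : Fin n,
      (((Finset.univ : Finset (Fin n)).filter fun j : Fin n =>
        ¬ ((i : ℕ) + 1 < j ∨ (j : ℕ) + 1 < i)).card : ℝ) ≤ 3 := by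
    intro i
    have h1 : ((Finset.univ : Finset (Fin n)).filter fun j : Fin n =>
        ¬ ((i : ℕ) + 1 < j ∨ (j : ℕ) + 1 < i)).card ≤
          (Finset.Icc ((i : ℕ) - 1) (i + 1)).card := by
      refine Finset.card_le_card_of_injOn (fun j => (j : ℕ)) ?_ Fin.val_injective.injOn
      intro j hj
      simp at hj ⊢
      omega
    have h2 : (Finset.Icc ((i : ℕ) - 1) (i + 1)).card ≤ 3 := by
      rw [Nat.card_Icc]; omega
    exact_mod_cast h1.trans h2
  simp_rw [Nat.succ_eq_add_one, rSeq_sub_eq_sum, sq, Finset.sum_mul_sum]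
  rw [Finset.sum_comm]
  calc ∑ i : Fin n, ∑ σ : Equiv.Perm (Fin (n + 1)), ∑ j, descSign σ i * descSign σ j
      ≤ ∑ i : Fin n, 3 * ((1 / 4) * ((n + 1).factorial : ℝ)) := by
        refine Finset.sum_le_sum fun i _ => ?_
        rw [Finset.sum_comm]
        calc ∑ j, ∑ σ : Equiv.Perm (Fin (n + 1)), descSign σ i * descSign σ j
            ≤ ∑ j : Fin n, if ¬ ((i : ℕ) + 1 < j ∨ (j : ℕ) + 1 < i) then
                (1 / 4) * ((n + 1).factorial : ℝ) else 0 := by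
              refine Finset.sum_le_sum fun j _ => ?_
              split_ifs with h
              · exact (sum_descSign_mul_eq_zero h).le
              · refine (Finset.sum_le_card_nsmul _ _ _ fun σ _ => descSign_mul_le σ i j).trans_eq ?_
                simp [Finset.card_univ, Fintype.card_perm, mul_comm]
          _ ≤ _ := by
              rw [← Finset.sum_filter, Finset.sum_const, nsmul_eq_mul]
              exact mul_le_mul_of_nonneg_right (hcard i) (by positivity)
    _ ≤ _ := by
        rw [Finset.sum_const, Finset.card_univ, Fintype.card_fin, nsmul_eq_mul]
        have : (0 : ℝ) ≤ (n + 1).factorial := by positivity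
        push_cast
        nlinarith [mul_nonneg (Nat.cast_nonneg (α := ℝ) n) this]

/-- Chebyshev's inequality for the number of rising sequences of a uniform permutation. -/
lemma sum_Us_filter_le {n : ℕ} (hn : 0 < n) {T : ℝ} (hT : 0 < T)
    (s : Finset (Equiv.Perm (Fin n))) (hs : ∀ σ ∈ s, T ≤ |(rSeq n σ : ℝ) - (n + 1) / 2|) :
    ∑ σ ∈ s, Us n σ ≤ n / T ^ 2 := by
  have hf : (0 : ℝ) < n.factorial := by positivity
  have h1 : (s.card : ℝ) * T ^ 2 ≤ (n : ℝ) * n.factorial := by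
    rw [← nsmul_eq_mul]
    refine (Finset.card_nsmul_le_sum s _ _ fun σ hσ => ?_).trans
      ((Finset.sum_le_univ_sum_of_nonneg fun σ => sq_nonneg _).trans (sum_rSeq_sub_sq_le hn))
    rw [← sq_abs (_ - _)]
    exact pow_le_pow_left₀ hT.le (hs σ hσ) 2
  simp only [Us, Finset.sum_const, nsmul_eq_mul]
  rw [le_div_iff₀ (by positivity), mul_right_comm, ← div_eq_mul_inv, div_le_iff₀ hf]
  exact h1

lemma sum_Us (n : ℕ) : ∑ σ, Us n σ = 1 := by
  have hf : (n.factorial : ℝ) ≠ 0 := by positivity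
  simp [Us, Finset.card_univ, Fintype.card_perm, hf]

lemma rSeq_le {n : ℕ} (hn : 0 < n) (σ : Equiv.Perm (Fin n)) : rSeq n σ ≤ n := by
  have := descCount_le n σ (n - 1)
  rw [rSeq_eq]
  omega

lemma one_le_rSeq (n : ℕ) (σ : Equiv.Perm (Fin n)) : 1 ≤ rSeq n σ := Nat.le_add_right 1 _

lemma Qs_eq_zero_of_lt {n m : ℕ} {σ : Equiv.Perm (Fin n)} (h : m < rSeq n σ) (hn : 0 < n) :
    Qs n m σ = 0 := by
  rw [Qs, Nat.choose_eq_zero_of_lt (by omega)]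
  simp

/-- The density of the `m`-shuffle with respect to the uniform distribution. -/
lemma Qs_eq_prod {n m : ℕ} {σ : Equiv.Perm (Fin n)} (hm : 0 < m) (h : rSeq n σ ≤ m) :
    Qs n m σ = Us n σ * ∏ j ∈ Finset.range n, (1 + ((n : ℝ) - rSeq n σ - j) / m) := by
  have hm' : (m : ℝ) ≠ 0 := by positivity
  have hf : (n.factorial : ℝ) ≠ 0 := by positivity
  have h1 : ((n + m - rSeq n σ).descFactorial n : ℝ) =
      ∏ j ∈ Finset.range n, ((m : ℝ) * (1 + ((n : ℝ) - rSeq n σ - j) / m)) := by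
    rw [Nat.descFactorial_eq_prod_range, Nat.cast_prod]
    refine Finset.prod_congr rfl fun j hj => ?_
    have hj' := Finset.mem_range.1 hj
    rw [Nat.cast_sub (by omega), Nat.cast_sub (by omega)]
    push_cast
    field_simp
    ring
  rw [Finset.prod_mul_distrib, Finset.prod_const, Finset.card_range,
    Nat.descFactorial_eq_factorial_mul_choose] at h1
  push_cast at h1
  rw [Qs, Us]
  generalize ∏ j ∈ Finset.range n, (1 + ((n : ℝ) - rSeq n σ - j) / m) = P at h1 ⊢
  field_simp
  linarith

lemma sum_range_sub (c : ℝ) (n : ℕ) :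
    ∑ j ∈ Finset.range n, (c - (j : ℝ)) = n * c - n * (n - 1) / 2 := by
  induction n with
  | zero => simp
  | succ n ih => rw [Finset.sum_range_succ, ih]; push_cast; ring

lemma sum_range_sub_sq (c : ℝ) (n : ℕ) :
    ∑ j ∈ Finset.range n, (c - (j : ℝ)) ^ 2 =
      n * c ^ 2 - c * n * (n - 1) + n * (n - 1) * (2 * n - 1) / 6 := by
  induction n with
  | zero => simp
  | succ n ih => rw [Finset.sum_range_succ, ih]; push_cast; ring

lemma exp_sub_two_mul_sq_le {x : ℝ} (hx : -(1 / 2) ≤ x) : Real.exp (x - 2 * x ^ 2) ≤ 1 + x := by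
  have hpos : 0 < 1 + x := by linarith
  have h1 : x - 2 * x ^ 2 ≤ x / (1 + x) := by
    rw [le_div_iff₀ hpos]
    nlinarith [mul_nonneg (sq_nonneg x) (by linarith : 0 ≤ 1 + 2 * x)]
  have h2 : 1 / (1 + x) ≤ Real.exp (-(x / (1 + x))) := by
    refine le_trans (le_of_eq ?_) (Real.add_one_le_exp _)
    field_simp
    ring
  rw [Real.exp_neg, ← one_div] at h2
  exact (Real.exp_le_exp.2 h1).trans ((one_div_le_one_div hpos (Real.exp_pos _)).1 h2)

lemma Us_mul_exp_le_Qs {n m : ℕ} (hn : 0 < n) (hm : 2 * n ≤ m) {T : ℝ} {σ : Equiv.Perm (Fin n)}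
    (hT : (rSeq n σ : ℝ) - (n + 1) / 2 ≤ T) :
    Us n σ * Real.exp (-(n * T / m) - 2 * n ^ 3 / m ^ 2) ≤ Qs n m σ := by
  have hr := rSeq_le hn σ
  have hr1 := one_le_rSeq n σ
  have hm0 : 0 < m := by omega
  have hmR : (0 : ℝ) < m := by positivity
  have hmn : 2 * (n : ℝ) ≤ m := by exact_mod_cast hm
  have hrR : (rSeq n σ : ℝ) ≤ n := by exact_mod_cast hr
  have hr1R : (1 : ℝ) ≤ rSeq n σ := by exact_mod_cast hr1
  rw [Qs_eq_prod hm0 (by omega)]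
  refine mul_le_mul_of_nonneg_left ?_ (by unfold Us; positivity)
  set r := (rSeq n σ : ℝ)
  have hb : ∀ j ∈ Finset.range n, -(n : ℝ) ≤ n - r - j ∧ (n : ℝ) - r - j ≤ n := by
    intro j hj
    have hj' : (j : ℝ) ≤ n := by exact_mod_cast (Finset.mem_range.1 hj).le
    have hj0 : (0 : ℝ) ≤ j := j.cast_nonneg
    constructor <;> linarith
  calc Real.exp (-(n * T / m) - 2 * n ^ 3 / m ^ 2)
      ≤ Real.exp (∑ j ∈ Finset.range n,
          (((n : ℝ) - r - j) / m - 2 * (((n : ℝ) - r - j) / m) ^ 2)) := by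
        rw [Real.exp_le_exp, Finset.sum_sub_distrib, ← Finset.sum_div, sum_range_sub]
        have h1 : -(n * T / m) ≤ (n * ((n : ℝ) - r) - n * (n - 1) / 2) / m := by
          rw [← neg_div]
          refine div_le_div_of_nonneg_right ?_ hmR.le
          nlinarith [mul_nonneg (Nat.cast_nonneg (α := ℝ) n) (sub_nonneg.2 hT)]
        have h2 : ∑ j ∈ Finset.range n, 2 * (((n : ℝ) - r - j) / m) ^ 2 ≤
            2 * (n : ℝ) ^ 3 / m ^ 2 := by
          refine (Finset.sum_le_card_nsmul _ _ (2 * ((n : ℝ) / m) ^ 2) fun j hj => ?_).trans_eq ?_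
          · rw [div_pow, div_pow]
            have := sq_le_sq' (hb j hj).1 (hb j hj).2
            gcongr
          · rw [Finset.card_range, nsmul_eq_mul]
            field_simp
        linarith
    _ = ∏ j ∈ Finset.range n,
          Real.exp (((n : ℝ) - r - j) / m - 2 * (((n : ℝ) - r - j) / m) ^ 2) := Real.exp_sum _ _
    _ ≤ _ := by
        refine Finset.prod_le_prod (fun _ _ => (Real.exp_pos _).le) fun j hj => ?_
        refine exp_sub_two_mul_sq_le ?_
        rw [le_div_iff₀ hmR]
        linarith [(hb j hj).1]

lemma Qs_le_Us_mul_exp {n m : ℕ} (hn : 0 < n) (hm : 0 < m) {T : ℝ}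
    {σ : Equiv.Perm (Fin n)} (hσ : -T ≤ (rSeq n σ : ℝ) - (n + 1) / 2) :
    Qs n m σ ≤ Us n σ *
      Real.exp (n / (2 * m ^ 2) * (2 * T * m + T ^ 2 - ((n : ℝ) ^ 2 - 1) / 12)) := by
  have hU : 0 ≤ Us n σ := by unfold Us; positivity
  rcases lt_or_ge m (rSeq n σ) with hlt | hr
  · rw [Qs_eq_zero_of_lt hlt hn]
    positivity
  have hmR : (0 : ℝ) < m := by positivity
  have hrR : (rSeq n σ : ℝ) ≤ m := by exact_mod_cast hr
  rw [Qs_eq_prod hm hr]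
  refine mul_le_mul_of_nonneg_left ?_ hU
  set r := (rSeq n σ : ℝ)
  have hx : ∀ j ∈ Finset.range n, 0 ≤ 1 + ((n : ℝ) - r - j) / m := by
    intro j hj
    have hj' : (j : ℝ) ≤ n := by exact_mod_cast (Finset.mem_range.1 hj).le
    have : -1 ≤ ((n : ℝ) - r - j) / m := by rw [le_div_iff₀ hmR]; linarith
    linarith
  have hx' : ∀ j ∈ Finset.range n, 0 ≤ 1 + ((n : ℝ) - r - (n - 1 - j : ℕ)) / m := by
    intro j hj
    exact hx _ (Finset.mem_range.2 (by have := Finset.mem_range.1 hj; omega))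
  refine le_of_sq_le_sq ?_ (Real.exp_pos _).le
  calc (∏ j ∈ Finset.range n, (1 + ((n : ℝ) - r - j) / m)) ^ 2
      = ∏ j ∈ Finset.range n, ((1 + ((n : ℝ) - r - j) / m) *
          (1 + ((n : ℝ) - r - (n - 1 - j : ℕ)) / m)) := by
        rw [Finset.prod_mul_distrib,
          Finset.prod_range_reflect (fun j : ℕ => 1 + ((n : ℝ) - r - j) / m), sq]
    _ ≤ ∏ j ∈ Finset.range n, Real.exp
          (2 * T / m + T ^ 2 / m ^ 2 - (((n : ℝ) - 1) / 2 - j) ^ 2 / m ^ 2) := by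
        refine Finset.prod_le_prod (fun j hj => mul_nonneg (hx j hj) (hx' j hj)) fun j hj => ?_
        refine le_trans ?_ (Real.add_one_le_exp _)
        have hj' := Finset.mem_range.1 hj
        rw [Nat.cast_sub (by omega), Nat.cast_sub (by omega)]
        have h1 : 0 ≤ m - (r - (n + 1) / 2) := by
          have : (0 : ℝ) ≤ n := n.cast_nonneg
          linarith
        have h2 : (m - (r - (n + 1) / 2)) ^ 2 ≤ (m + T) ^ 2 :=
          pow_le_pow_left₀ h1 (by linarith) 2
        push_cast
        have e1 : (1 + ((n : ℝ) - r - j) / m) * (1 + ((n : ℝ) - r - (n - 1 - j)) / m) =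
            ((m - (r - (n + 1) / 2)) ^ 2 - (((n : ℝ) - 1) / 2 - j) ^ 2) / m ^ 2 := by
          field_simp
          ring
        have e2 : 2 * T / m + T ^ 2 / m ^ 2 - (((n : ℝ) - 1) / 2 - j) ^ 2 / m ^ 2 + 1 =
            ((m + T) ^ 2 - (((n : ℝ) - 1) / 2 - j) ^ 2) / m ^ 2 := by
          field_simp
          ring
        rw [e1, e2]
        gcongr
    _ = _ := by
        rw [← Real.exp_sum, ← Real.exp_nat_mul, Finset.sum_sub_distrib, ← Finset.sum_div,
          sum_range_sub_sq, Finset.sum_const, Finset.card_range, nsmul_eq_mul]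
        congr 1
        push_cast
        field_simp
        ring

lemma Us_nonneg (n : ℕ) (σ : Equiv.Perm (Fin n)) : 0 ≤ Us n σ := by
  unfold Us; positivity

section TotalVariation

variable {n : ℕ} {Q : Equiv.Perm (Fin n) → ℝ}

lemma tv_nonneg (n : ℕ) (Q R : Equiv.Perm (Fin n) → ℝ) : 0 ≤ tv n Q R := by
  unfold tv; positivity

lemma tv_Us_le_one (h0 : ∀ σ, 0 ≤ Q σ) (h1 : ∑ σ, Q σ = 1) : tv n Q (Us n) ≤ 1 := by
  have h : ∑ σ, |Q σ - Us n σ| ≤ ∑ σ, (Q σ + Us n σ) :=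
    Finset.sum_le_sum fun σ _ => abs_le.2 ⟨by linarith [h0 σ], by linarith [Us_nonneg n σ]⟩
  rw [Finset.sum_add_distrib, h1, sum_Us] at h
  unfold tv
  linarith

lemma le_tv_Us (h1 : ∑ σ, Q σ = 1) (B : Finset (Equiv.Perm (Fin n))) :
    1 - ∑ σ ∈ B, Q σ - ∑ σ ∈ Bᶜ, Us n σ ≤ tv n Q (Us n) := by
  have hQ := Finset.sum_add_sum_compl B Q
  have hU := Finset.sum_add_sum_compl B (Us n)
  rw [sum_Us] at hU
  rw [h1] at hQ
  have h2 : ∑ σ ∈ B, (Us n σ - Q σ) ≤ ∑ σ ∈ B, |Q σ - Us n σ| :=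
    Finset.sum_le_sum fun σ _ => (le_abs_self _).trans_eq (abs_sub_comm _ _)
  have h3 : ∑ σ ∈ Bᶜ, (Q σ - Us n σ) ≤ ∑ σ ∈ Bᶜ, |Q σ - Us n σ| :=
    Finset.sum_le_sum fun σ _ => le_abs_self _
  have h4 := Finset.sum_add_sum_compl B fun σ => |Q σ - Us n σ|
  rw [Finset.sum_sub_distrib] at h2 h3
  unfold tv
  linarith

lemma tv_Us_le (h0 : ∀ σ, 0 ≤ Q σ) (h1 : ∑ σ, Q σ = 1) {c : ℝ} (hc : c ≤ 1)
    (G : Finset (Equiv.Perm (Fin n))) (hG : ∀ σ ∈ G, c * Us n σ ≤ Q σ) :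
    tv n Q (Us n) ≤ 1 - c + ∑ σ ∈ Gᶜ, Us n σ := by
  have hU := Finset.sum_add_sum_compl G (Us n)
  have hQ := Finset.sum_add_sum_compl G Q
  rw [sum_Us] at hU
  rw [h1] at hQ
  have hU0 : 0 ≤ ∑ σ ∈ Gᶜ, Us n σ := Finset.sum_nonneg fun σ _ => Us_nonneg n σ
  have h2 : ∑ σ ∈ G, |Q σ - Us n σ| ≤ ∑ σ ∈ G, (Q σ - Us n σ + 2 * (1 - c) * Us n σ) := by
    refine Finset.sum_le_sum fun σ hσ => ?_
    have := hG σ hσ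
    have := mul_nonneg (sub_nonneg.2 hc) (Us_nonneg n σ)
    exact abs_le.2 ⟨by linarith, by linarith⟩
  have h3 : ∑ σ ∈ Gᶜ, |Q σ - Us n σ| ≤ ∑ σ ∈ Gᶜ, (Q σ - Us n σ + 2 * Us n σ) :=
    Finset.sum_le_sum fun σ _ => abs_le.2 ⟨by linarith [h0 σ], by linarith [Us_nonneg n σ]⟩
  have h4 := Finset.sum_add_sum_compl G fun σ => |Q σ - Us n σ|
  simp only [Finset.sum_add_distrib, Finset.sum_sub_distrib, ← Finset.mul_sum] at h2 h3
  have h5 : (1 - c) * ∑ σ ∈ G, Us n σ ≤ 1 - c :=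
    mul_le_of_le_one_right (sub_nonneg.2 hc) (by linarith)
  unfold tv
  linarith

end TotalVariation

section Mixture

open ProbabilityTheory

variable {Ω : Type*} [MeasurableSpace Ω] {P : Measure Ω} [IsProbabilityMeasure P] {n : ℕ}

lemma integrable_Qs_comp (hn : 0 < n) {M : Ω → ℕ} (hM : Measurable M)
    (σ : Equiv.Perm (Fin n)) : Integrable (fun ω => Qs n (M ω) σ) P := by
  refine Integrable.of_bound (C := 1)
    ((measurable_from_top (f := fun m => Qs n m σ)).comp hM).aestronglyMeasurable ?_
  refine ae_of_all _ fun ω => ?_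
  rw [Real.norm_eq_abs, abs_of_nonneg (Qs_nonneg _ _ _)]
  exact Qs_le_one hn _ _

lemma sum_integral_Qs (hn : 0 < n) {M : Ω → ℕ} (hM : Measurable M) (hpos : ∀ᵐ ω ∂P, 0 < M ω) :
    ∑ σ, ∫ ω, Qs n (M ω) σ ∂P = 1 := by
  rw [← integral_finsetSum _ fun σ _ => integrable_Qs_comp hn hM σ]
  rw [integral_congr_ae (g := fun _ => (1 : ℝ)) (hpos.mono fun ω hω => sum_Qs hn hω)]
  simp

lemma mul_Us_le_integral_Qs (hn : 0 < n) {M : Ω → ℕ} (hM : Measurable M) {c m₀ : ℝ}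
    {σ : Equiv.Perm (Fin n)} (h : ∀ m : ℕ, m₀ ≤ m → c * Us n σ ≤ Qs n m σ) :
    c * P.real {ω | m₀ ≤ M ω} * Us n σ ≤ ∫ ω, Qs n (M ω) σ ∂P := by
  have hs : MeasurableSet {ω | m₀ ≤ (M ω : ℝ)} :=
    measurableSet_le measurable_const (measurable_from_top.comp hM)
  have h1 : ∫ ω, {ω | m₀ ≤ (M ω : ℝ)}.indicator (fun _ => c * Us n σ) ω ∂P =
      c * P.real {ω | m₀ ≤ M ω} * Us n σ := by
    rw [integral_indicator_const _ hs, smul_eq_mul]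
    ring
  rw [← h1]
  refine integral_mono ((integrable_const _).indicator hs) (integrable_Qs_comp hn hM σ) fun ω => ?_
  by_cases hω : m₀ ≤ (M ω : ℝ)
  · rw [Set.indicator_of_mem (by exact hω)]
    exact h _ hω
  · rw [Set.indicator_of_notMem (by exact hω)]
    exact Qs_nonneg _ _ _

lemma sum_integral_Qs_le (hn : 0 < n) {M : Ω → ℕ} (hM : Measurable M) {x m₁ : ℝ} (hx : 0 ≤ x)
    (B : Finset (Equiv.Perm (Fin n))) (h : ∀ m : ℕ, m ≤ m₁ → ∑ σ ∈ B, Qs n m σ ≤ x) :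
    ∑ σ ∈ B, ∫ ω, Qs n (M ω) σ ∂P ≤ x + P.real {ω | m₁ < M ω} := by
  have hs : MeasurableSet {ω | m₁ < (M ω : ℝ)} :=
    measurableSet_lt measurable_const (measurable_from_top.comp hM)
  have hi : Integrable ({ω | m₁ < (M ω : ℝ)}.indicator fun _ => (1 : ℝ)) P :=
    (integrable_const _).indicator hs
  rw [← integral_finsetSum _ fun σ _ => integrable_Qs_comp hn hM σ]
  have h1 : ∫ ω, (x + {ω | m₁ < (M ω : ℝ)}.indicator (fun _ => (1 : ℝ)) ω) ∂P =
      x + P.real {ω | m₁ < M ω} := by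
    rw [integral_add (integrable_const _) hi, integral_indicator_const _ hs]
    simp
  rw [← h1]
  refine integral_mono (integrable_finsetSum _ fun σ _ => integrable_Qs_comp hn hM σ)
    ((integrable_const _).add hi) fun ω => ?_
  by_cases hω : m₁ < (M ω : ℝ)
  · simp only [Set.indicator_of_mem (show ω ∈ {ω | m₁ < (M ω : ℝ)} from hω)]
    refine (Finset.sum_le_univ_sum_of_nonneg fun σ => Qs_nonneg _ _ _).trans ?_
    linarith [sum_Qs_le_one hn (M ω)]
  · simp only [Set.indicator_of_notMem (show ω ∉ {ω | m₁ < (M ω : ℝ)} from hω), add_zero]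
    exact h _ (not_lt.1 hω)

end Mixture

section Steps

open ProbabilityTheory

/-- The distribution `p`, as a measure on `ℕ`. -/
def stepMeasure (p : ℕ → ℝ) : Measure ℕ :=
  Measure.sum fun k => ENNReal.ofReal (p k) • Measure.dirac k

variable {p : ℕ → ℝ}

lemma isProbabilityMeasure_stepMeasure (hp0 : ∀ k, 0 ≤ p k) (hpsum : ∑' k, p k = 1) :
    IsProbabilityMeasure (stepMeasure p) := by
  have hs : Summable p := by
    by_contra h
    rw [tsum_eq_zero_of_not_summable h] at hpsum
    exact zero_ne_one hpsum
  exact HasSum.isProbabilityMeasure_sum_dirac hp0 (hpsum ▸ hs.hasSum)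

lemma integral_stepMeasure (hp0 : ∀ k, 0 ≤ p k) (f : ℕ → ℝ) :
    ∫ k, f k ∂stepMeasure p = ∑' k, p k * f k := by
  rw [stepMeasure, integral_sum_dirac fun _ => ENNReal.ofReal_ne_top]
  simp [hp0]

variable {Ω : Type*} [MeasurableSpace Ω] {P : Measure Ω} {X : ℕ → Ω → ℕ}

lemma integral_comp_step (hp0 : ∀ k, 0 ≤ p k) (hX : ∀ i, Measurable (X i))
    (hlaw : ∀ i, P.map (X i) = stepMeasure p) (i : ℕ) (f : ℕ → ℝ) :
    ∫ ω, f (X i ω) ∂P = ∑' k, p k * f k := by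
  rw [← integral_stepMeasure hp0, ← hlaw i,
    integral_map (hX i).aemeasurable measurable_from_top.aestronglyMeasurable]

lemma ae_step_pos (hpz : p 0 = 0) (hX : ∀ i, Measurable (X i))
    (hlaw : ∀ i, P.map (X i) = stepMeasure p) : ∀ᵐ ω ∂P, ∀ i, 0 < X i ω := by
  rw [ae_all_iff]
  intro i
  have h : ∀ᵐ k ∂P.map (X i), 0 < k := by
    rw [hlaw, stepMeasure, Measure.ae_sum_iff]
    intro k
    rcases k.eq_zero_or_pos with rfl | hk
    · simp [hpz]
    · exact Measure.ae_smul_measure (by simpa [ae_dirac_eq] using hk) _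
  exact ae_of_ae_map (hX i).aemeasurable h

variable [IsProbabilityMeasure P]

/-- Iterated `p`-shuffles are shuffles with a random number of piles, the product of independent
samples from `p`. -/
lemma iterConv_Qp_eq_integral (hp0 : ∀ k, 0 ≤ p k) (hX : ∀ i, Measurable (X i))
    (hind : iIndepFun X P) (hlaw : ∀ i, P.map (X i) = stepMeasure p) {n : ℕ} (hn : 0 < n)
    (k : ℕ) (σ : Equiv.Perm (Fin n)) :
    iterConv n (Qp n p) k σ = ∫ ω, Qs n (∏ i ∈ Finset.range k, X i ω) σ ∂P := by
  induction k generalizing σ with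
  | zero => simp [iterConv, Qs_one hn]
  | succ k ih =>
    have hM : Measurable fun ω => ∏ i ∈ Finset.range k, X i ω :=
      Finset.measurable_fun_prod _ fun i _ => hX i
    have hI : IndepFun (X k) (fun ω => ∏ i ∈ Finset.range k, X i ω) P := by
      have := (hind.indepFun_prod_range_succ hX k).symm
      convert this using 1
      ext ω; simp
    calc iterConv n (Qp n p) (k + 1) σ
        = ∑ τ, (∫ ω, Qs n (X k ω) (σ * τ⁻¹) ∂P) *
            ∫ ω, Qs n (∏ i ∈ Finset.range k, X i ω) τ ∂P := by
          simp only [iterConv, convol, ih]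
          refine Finset.sum_congr rfl fun τ _ => ?_
          rw [integral_comp_step hp0 hX hlaw k fun m => Qs n m (σ * τ⁻¹), Qp]
      _ = ∑ τ, ∫ ω, Qs n (X k ω) (σ * τ⁻¹) * Qs n (∏ i ∈ Finset.range k, X i ω) τ ∂P := by
          refine Finset.sum_congr rfl fun τ _ => ?_
          exact (hI.integral_fun_comp_mul_comp (f := fun m => Qs n m (σ * τ⁻¹))
            (g := fun m => Qs n m τ) (hX k).aemeasurable hM.aemeasurable
            measurable_from_top.aestronglyMeasurable
            measurable_from_top.aestronglyMeasurable).symm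
      _ = ∫ ω, ∑ τ, Qs n (X k ω) (σ * τ⁻¹) * Qs n (∏ i ∈ Finset.range k, X i ω) τ ∂P := by
          refine (integral_finsetSum _ fun τ _ => ?_).symm
          refine (integrable_Qs_comp hn (hX k) _).mul_bdd (c := 1)
            (integrable_Qs_comp hn hM τ).aestronglyMeasurable (ae_of_all _ fun ω => ?_)
          rw [Real.norm_eq_abs, abs_of_nonneg (Qs_nonneg _ _ _)]
          exact Qs_le_one hn _ _
      _ = _ := by
          congr 1 with ω
          rw [Finset.prod_range_succ, mul_comm _ (X k ω), ← convol_Qs hn]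
          rfl

/-- The weak law of large numbers for the logarithm of the number of piles. -/
lemma tendsto_measureReal_log_sum (hp0 : ∀ k, 0 ≤ p k) (hX : ∀ i, Measurable (X i))
    (hind : iIndepFun X P) (hlaw : ∀ i, P.map (X i) = stepMeasure p)
    (hsum : Summable fun k : ℕ => p k * Real.log k) {η : ℝ} (hη : 0 < η) :
    Tendsto (fun k : ℕ => P.real {ω | η ≤ |(∑ i ∈ Finset.range k, Real.log (X i ω)) / k -
      ∑' k, p k * Real.log k|}) atTop (nhds 0) := by
  have hmeas : ∀ i, Measurable fun ω => Real.log (X i ω) := fun i =>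
    (measurable_from_top (f := fun m : ℕ => Real.log m)).comp (hX i)
  have hint : Integrable (fun ω => Real.log (X 0 ω)) P := by
    have h : Integrable (fun k : ℕ => Real.log k) (P.map (X 0)) := by
      rw [hlaw, stepMeasure]
      refine integrable_sum_dirac (fun _ => ENNReal.ofReal_ne_top) ?_
      refine hsum.congr fun k => ?_
      rw [ENNReal.toReal_ofReal (hp0 k), Real.norm_eq_abs, abs_of_nonneg (Real.log_natCast_nonneg k)]
    exact h.comp_measurable (hX 0)
  have hslln := strong_law_ae_real (fun i ω => Real.log (X i ω)) hint
    (fun i j hij => (hind.indepFun hij).comp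
      (measurable_from_top (f := fun m : ℕ => Real.log m))
      (measurable_from_top (f := fun m : ℕ => Real.log m)))
    (fun i => (IdentDistrib.mk (hX i).aemeasurable (hX 0).aemeasurable
      ((hlaw i).trans (hlaw 0).symm)).comp (measurable_from_top (f := fun m : ℕ => Real.log m)))
  rw [integral_comp_step hp0 hX hlaw 0 fun m => Real.log m] at hslln
  have h := tendstoInMeasure_of_tendsto_ae (fun k => ((Finset.measurable_fun_sum _ fun i _ =>
    hmeas i).div_const (k : ℝ)).aestronglyMeasurable) hslln
  exact tendstoInMeasure_iff_measureReal_norm.1 h η hη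

end Steps

section Bounds

variable {Ω : Type*} [MeasurableSpace Ω] {P : Measure Ω} [IsProbabilityMeasure P] {n : ℕ}
  {M : Ω → ℕ}

/-- A random number of piles that is typically at least `n ^ (3 / 2 + δ)` mixes. -/
lemma tv_integral_Qs_le (hn : 0 < n) (hM : Measurable M) (hpos : ∀ᵐ ω ∂P, 0 < M ω) {δ : ℝ}
    (h2n : 2 * (n : ℝ) ≤ (n : ℝ) ^ (3 / 2 + δ)) :
    tv n (fun σ => ∫ ω, Qs n (M ω) σ ∂P) (Us n) ≤
      1 - Real.exp (-(n : ℝ) ^ (-(δ / 2)) - 2 * (n : ℝ) ^ (-(2 * δ))) *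
        P.real {ω | (n : ℝ) ^ (3 / 2 + δ) ≤ M ω} + (n : ℝ) ^ (-δ) := by
  have hnR : (0 : ℝ) < n := by positivity
  set T : ℝ := (n : ℝ) ^ (1 / 2 + δ / 2) with hT
  set m₀ : ℝ := (n : ℝ) ^ (3 / 2 + δ) with hm₀
  have hTpos : 0 < T := by positivity
  have hm₀pos : 0 < m₀ := by positivity
  set c : ℝ := Real.exp (-(n : ℝ) ^ (-(δ / 2)) - 2 * (n : ℝ) ^ (-(2 * δ))) with hc
  have hc1 : c ≤ 1 := by
    rw [hc, Real.exp_le_one_iff]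
    have h1 : (0 : ℝ) ≤ (n : ℝ) ^ (-(δ / 2)) := by positivity
    have h2 : (0 : ℝ) ≤ (n : ℝ) ^ (-(2 * δ)) := by positivity
    linarith
  have e1 : n * T / m₀ = (n : ℝ) ^ (-(δ / 2)) := by
    rw [hT, hm₀]
    nth_rewrite 1 [← Real.rpow_one (n : ℝ)]
    rw [← Real.rpow_add hnR, ← Real.rpow_sub hnR]
    congr 1
    ring
  have e2 : (n : ℝ) ^ 3 / m₀ ^ 2 = (n : ℝ) ^ (-(2 * δ)) := by
    rw [hm₀, ← Real.rpow_natCast, ← Real.rpow_natCast, ← Real.rpow_mul hnR.le,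
      ← Real.rpow_sub hnR]
    congr 1
    push_cast
    ring
  have e3 : n / T ^ 2 = (n : ℝ) ^ (-δ) := by
    rw [hT, ← Real.rpow_natCast, ← Real.rpow_mul hnR.le]
    nth_rewrite 1 [← Real.rpow_one (n : ℝ)]
    rw [← Real.rpow_sub hnR]
    congr 1
    push_cast
    ring
  let G : Finset (Equiv.Perm (Fin n)) :=
    Finset.univ.filter fun σ => (rSeq n σ : ℝ) - (n + 1) / 2 ≤ T
  have hG : ∀ σ ∈ G, c * P.real {ω | m₀ ≤ M ω} * Us n σ ≤ ∫ ω, Qs n (M ω) σ ∂P := by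
    intro σ hσ
    refine mul_Us_le_integral_Qs hn hM fun m hm => ?_
    have hm2 : 2 * n ≤ m := by exact_mod_cast h2n.trans hm
    refine le_trans ?_ (Us_mul_exp_le_Qs hn hm2 (Finset.mem_filter.1 hσ).2)
    rw [mul_comm]
    refine mul_le_mul_of_nonneg_left (Real.exp_le_exp.2 ?_) (Us_nonneg n σ)
    rw [← e1, ← e2, ← mul_div_assoc]
    gcongr
  have hGc : ∑ σ ∈ Gᶜ, Us n σ ≤ n / T ^ 2 := by
    refine sum_Us_filter_le hn hTpos _ fun σ hσ => ?_
    have h : ¬ (rSeq n σ : ℝ) - (n + 1) / 2 ≤ T := by simpa [G] using hσ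
    exact (not_le.1 h).le.trans (le_abs_self _)
  have hcP : c * P.real {ω | m₀ ≤ M ω} ≤ 1 :=
    mul_le_one₀ hc1 measureReal_nonneg measureReal_le_one
  have := tv_Us_le (fun σ => integral_nonneg fun ω => Qs_nonneg n (M ω) σ)
    (sum_integral_Qs hn hM hpos) hcP G hG
  rw [e3] at hGc
  linarith

/-- A random number of piles that is typically at most `n ^ (3 / 2 - δ)` does not mix. -/
lemma le_tv_integral_Qs (hn : 0 < n) (hM : Measurable M) (hpos : ∀ᵐ ω ∂P, 0 < M ω) {δ : ℝ}
    (hlarge : 2 * (n : ℝ) ^ (-(δ / 2)) + (n : ℝ) ^ (-(1 - δ)) + (n : ℝ) ^ (-2 : ℝ) ≤ 1 / 24) :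
    1 - Real.exp (-(n : ℝ) ^ (2 * δ) / 48) - P.real {ω | (n : ℝ) ^ (3 / 2 - δ) < M ω} -
      (n : ℝ) ^ (-δ) ≤ tv n (fun σ => ∫ ω, Qs n (M ω) σ ∂P) (Us n) := by
  have hnR : (0 : ℝ) < n := by positivity
  set T : ℝ := (n : ℝ) ^ (1 / 2 + δ / 2) with hT
  set m₁ : ℝ := (n : ℝ) ^ (3 / 2 - δ) with hm₁
  have hTpos : 0 < T := by positivity
  have hm₁pos : 0 < m₁ := by positivity
  have e1 : T * m₁ = (n : ℝ) ^ 2 * (n : ℝ) ^ (-(δ / 2)) := by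
    rw [hT, hm₁, ← Real.rpow_natCast, ← Real.rpow_add hnR, ← Real.rpow_add hnR]
    congr 1
    push_cast
    ring
  have e2 : T ^ 2 = (n : ℝ) ^ 2 * (n : ℝ) ^ (-(1 - δ)) := by
    rw [hT, ← Real.rpow_natCast, ← Real.rpow_natCast, ← Real.rpow_mul hnR.le,
      ← Real.rpow_add hnR]
    congr 1
    push_cast
    ring
  have e3 : n / T ^ 2 = (n : ℝ) ^ (-δ) := by
    rw [hT, ← Real.rpow_natCast, ← Real.rpow_mul hnR.le]
    nth_rewrite 1 [← Real.rpow_one (n : ℝ)]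
    rw [← Real.rpow_sub hnR]
    congr 1
    push_cast
    ring
  have e4 : (1 : ℝ) = (n : ℝ) ^ 2 * (n : ℝ) ^ (-2 : ℝ) := by
    rw [← Real.rpow_natCast, ← Real.rpow_add hnR]
    norm_num
  have e5 : (n : ℝ) ^ (2 * δ) = n ^ 3 / m₁ ^ 2 := by
    rw [hm₁, ← Real.rpow_natCast, ← Real.rpow_natCast, ← Real.rpow_mul hnR.le,
      ← Real.rpow_sub hnR]
    congr 1
    push_cast
    ring
  have hneg : 2 * T * m₁ + T ^ 2 - ((n : ℝ) ^ 2 - 1) / 12 ≤ -((n : ℝ) ^ 2 / 24) := by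
    have := mul_le_mul_of_nonneg_left hlarge (sq_nonneg (n : ℝ))
    rw [mul_add, mul_add, ← e2, ← e4] at this
    linarith
  let B : Finset (Equiv.Perm (Fin n)) :=
    Finset.univ.filter fun σ => -T ≤ (rSeq n σ : ℝ) - (n + 1) / 2
  have hB : ∀ m : ℕ, (m : ℝ) ≤ m₁ →
      ∑ σ ∈ B, Qs n m σ ≤ Real.exp (-(n : ℝ) ^ (2 * δ) / 48) := by
    intro m hm
    rcases m.eq_zero_or_pos with rfl | hm0
    · simpa [Qs_zero hn] using (Real.exp_pos _).le
    have hmR : (0 : ℝ) < m := by positivity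
    have hexp : n / (2 * (m : ℝ) ^ 2) * (2 * T * m + T ^ 2 - ((n : ℝ) ^ 2 - 1) / 12) ≤
        -(n : ℝ) ^ (2 * δ) / 48 := by
      calc n / (2 * (m : ℝ) ^ 2) * (2 * T * m + T ^ 2 - ((n : ℝ) ^ 2 - 1) / 12)
          ≤ n / (2 * (m : ℝ) ^ 2) * (-((n : ℝ) ^ 2 / 24)) := by
            refine mul_le_mul_of_nonneg_left (le_trans ?_ hneg) (by positivity)
            gcongr
        _ = -((n : ℝ) ^ 3 / m ^ 2) / 48 := by field_simp; ring
        _ ≤ _ := by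
            rw [e5]
            gcongr
    calc ∑ σ ∈ B, Qs n m σ
        ≤ ∑ σ ∈ B, Us n σ * Real.exp (-(n : ℝ) ^ (2 * δ) / 48) := by
          refine Finset.sum_le_sum fun σ hσ => ?_
          refine (Qs_le_Us_mul_exp hn hm0 (Finset.mem_filter.1 hσ).2).trans ?_
          exact mul_le_mul_of_nonneg_left (Real.exp_le_exp.2 hexp) (Us_nonneg n σ)
      _ ≤ 1 * Real.exp (-(n : ℝ) ^ (2 * δ) / 48) := by
          rw [← Finset.sum_mul, ← sum_Us n]
          refine mul_le_mul_of_nonneg_right ?_ (Real.exp_pos _).le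
          exact Finset.sum_le_univ_sum_of_nonneg (Us_nonneg n)
      _ = _ := one_mul _
  have hBc : ∑ σ ∈ Bᶜ, Us n σ ≤ n / T ^ 2 := by
    refine sum_Us_filter_le hn hTpos _ fun σ hσ => ?_
    have h : ¬ -T ≤ (rSeq n σ : ℝ) - (n + 1) / 2 := by simpa [B] using hσ
    exact (le_neg.1 (not_le.1 h).le).trans (neg_le_abs _)
  have h1 := sum_integral_Qs_le (P := P) hn hM (Real.exp_pos _).le B hB
  have h2 := le_tv_Us (sum_integral_Qs hn hM hpos) B
  rw [e3] at hBc
  linarith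

end Bounds

lemma tendsto_natCast_rpow_neg {a : ℝ} (ha : 0 < a) :
    Tendsto (fun n : ℕ => (n : ℝ) ^ (-a)) atTop (nhds 0) :=
  (tendsto_rpow_neg_atTop ha).comp tendsto_natCast_atTop_atTop

lemma tsum_mul_log_pos {p : ℕ → ℝ} (hp0 : ∀ k, 0 ≤ p k) (hpz : p 0 = 0)
    (hpsum : ∑' k, p k = 1) (hp1 : p 1 < 1) (hsum : Summable fun k : ℕ => p k * Real.log k) :
    0 < ∑' k : ℕ, p k * Real.log k := by
  obtain ⟨k, hk, hpk⟩ : ∃ k, 2 ≤ k ∧ 0 < p k := by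
    by_contra! h
    have h1 : ∑' k, p k = p 1 := tsum_eq_single 1 fun k hk => by
      rcases Nat.lt_or_ge k 2 with hk2 | hk2
      · obtain rfl : k = 0 := by omega
        exact hpz
      · exact le_antisymm (h k hk2) (hp0 k)
    linarith
  refine hsum.tsum_pos (fun i => mul_nonneg (hp0 i) (Real.log_natCast_nonneg i)) k
    (mul_pos hpk (Real.log_pos (by exact_mod_cast hk)))

/-- Total variation cutoff at time `(3/(2μ))·log n` for `p`-shuffles, where
`μ = Σ p(k) log k < ∞`. -/
theorem p_shuffle_cutoff (p : ℕ → ℝ) (hp0 : ∀ k, 0 ≤ p k) (hpz : p 0 = 0)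
    (hpsum : ∑' k : ℕ, p k = 1) (hp1 : p 1 < 1)
    (hsum : Summable fun k : ℕ => p k * Real.log k)
    (μ : ℝ) (hμ : μ = ∑' k : ℕ, p k * Real.log k)
    (ε : ℝ) (hε : ε ∈ Set.Ioo (0 : ℝ) 1) :
    (∀ k : ℕ → ℕ, (∀ n : ℕ, (1 + ε) * (3 / (2 * μ)) * Real.log n < (k n : ℝ)) →
      Filter.Tendsto (fun n => tv n (iterConv n (Qp n p) (k n)) (Us n))
        Filter.atTop (nhds 0)) ∧
    (∀ k : ℕ → ℕ, (∀ n : ℕ, 2 ≤ n → (k n : ℝ) < (1 - ε) * (3 / (2 * μ)) * Real.log n) →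
      Filter.Tendsto (fun n => tv n (iterConv n (Qp n p) (k n)) (Us n))
        Filter.atTop (nhds 1)) := by
  obtain ⟨hε0, hε1⟩ := hε
  have hμpos : 0 < μ := hμ ▸ tsum_mul_log_pos hp0 hpz hpsum hp1 hsum
  have := isProbabilityMeasure_stepMeasure hp0 hpsum
  let P : Measure (ℕ → ℕ) := Measure.infinitePi fun _ => stepMeasure p
  let X : ℕ → (ℕ → ℕ) → ℕ := fun i ω => ω i
  have hX : ∀ i, Measurable (X i) := fun i => measurable_pi_apply i
  have hind : ProbabilityTheory.iIndepFun X P :=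
    ProbabilityTheory.iIndepFun_infinitePi (X := fun _ x => x) fun _ => measurable_id
  have hlaw : ∀ i, P.map (X i) = stepMeasure p := fun i =>
    (measurePreserving_eval_infinitePi (fun _ : ℕ => stepMeasure p) i).map_eq
  have hXpos := ae_step_pos hpz hX hlaw
  have hM : ∀ k, Measurable fun ω => ∏ i ∈ Finset.range k, X i ω := fun k =>
    Finset.measurable_fun_prod _ fun i _ => hX i
  have hMpos : ∀ k, ∀ᵐ ω ∂P, 0 < ∏ i ∈ Finset.range k, X i ω := fun k =>
    hXpos.mono fun ω hω => Finset.prod_pos fun i _ => hω i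
  have hlog : ∀ k, ∀ᵐ ω ∂P, Real.log (∏ i ∈ Finset.range k, X i ω : ℕ) =
      ∑ i ∈ Finset.range k, Real.log (X i ω) := fun k =>
    hXpos.mono fun ω hω => by
      rw [Nat.cast_prod, Real.log_prod fun i _ => by exact_mod_cast (hω i).ne']
  have hmix : ∀ n, 0 < n → ∀ k, iterConv n (Qp n p) k =
      fun σ => ∫ ω, Qs n (∏ i ∈ Finset.range k, X i ω) σ ∂P := fun n hn k =>
    funext fun σ => iterConv_Qp_eq_integral hp0 hX hind hlaw hn k σ
  have hη : 0 < μ * ε / 4 := by positivity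
  have hlln := tendsto_measureReal_log_sum hp0 hX hind hlaw hsum hη
  rw [← hμ] at hlln
  set bad : ℕ → Set (ℕ → ℕ) := fun k =>
    {ω | μ * ε / 4 ≤ |(∑ i ∈ Finset.range k, Real.log (X i ω)) / k - μ|} with hbad
  have hbadm : ∀ k, MeasurableSet (bad k) := fun k =>
    measurableSet_le measurable_const (((Finset.measurable_fun_sum _ fun i _ =>
      (measurable_from_top (f := fun m : ℕ => Real.log m)).comp (hX i)).div_const
        (k : ℝ)).sub_const μ).abs
  set δ : ℝ := 3 * ε / 4 with hδ
  have hδ0 : 0 < δ := by positivity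
  have hlogtop : Tendsto (fun n : ℕ => Real.log n) atTop atTop :=
    Real.tendsto_log_atTop.comp tendsto_natCast_atTop_atTop
  have hlim1 := tendsto_natCast_rpow_neg (half_pos hδ0)
  have hlim2 := tendsto_natCast_rpow_neg (mul_pos two_pos hδ0)
  have hlim3 := tendsto_natCast_rpow_neg hδ0
  constructor
  · intro k hk
    have hktop : Tendsto k atTop atTop := by
      rw [← tendsto_natCast_atTop_iff (R := ℝ)]
      exact tendsto_atTop_mono (fun n => (hk n).le)
        (hlogtop.const_mul_atTop (by positivity : 0 < (1 + ε) * (3 / (2 * μ))))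
    have hprob : ∀ᶠ n : ℕ in atTop, 1 - P.real (bad (k n)) ≤
        P.real {ω | (n : ℝ) ^ (3 / 2 + δ) ≤ (∏ i ∈ Finset.range (k n), X i ω : ℕ)} := by
      filter_upwards [eventually_ge_atTop 1] with n hn
      rw [← probReal_compl_eq_one_sub (hbadm _)]
      refine ENNReal.toReal_mono (measure_ne_top _ _) (measure_mono_ae ?_)
      filter_upwards [hlog (k n), hMpos (k n)] with ω h1 h2 hω
      have hnR : (0 : ℝ) < n := by exact_mod_cast hn
      have hL : 0 ≤ Real.log n := Real.log_natCast_nonneg n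
      have hk0 : (0 : ℝ) < k n := lt_of_le_of_lt (by positivity) (hk n)
      have hω' : |(∑ i ∈ Finset.range (k n), Real.log (X i ω)) / k n - μ| < μ * ε / 4 :=
        not_le.1 hω
      have h3 := (abs_lt.1 hω').1
      have h4 : μ * (1 - ε / 4) < (∑ i ∈ Finset.range (k n), Real.log (X i ω)) / k n := by
        linarith
      rw [lt_div_iff₀ hk0, ← h1] at h4
      change (n : ℝ) ^ (3 / 2 + δ) ≤ _
      rw [Real.rpow_def_of_pos hnR,
        ← Real.le_log_iff_exp_le (by exact_mod_cast h2)]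
      refine le_trans ?_ h4.le
      have h5 : 0 < μ * (1 - ε / 4) := mul_pos hμpos (by linarith)
      refine le_trans ?_ (mul_le_mul_of_nonneg_left (hk n).le h5.le)
      have h6 : μ * (1 - ε / 4) * ((1 + ε) * (3 / (2 * μ)) * Real.log n) =
          Real.log n * (3 / 2 * ((1 - ε / 4) * (1 + ε))) := by
        field_simp
      rw [h6]
      refine mul_le_mul_of_nonneg_left ?_ hL
      rw [hδ]
      nlinarith
    have h2n : ∀ᶠ n : ℕ in atTop, 2 * (n : ℝ) ≤ (n : ℝ) ^ (3 / 2 + δ) := by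
      have h := tendsto_natCast_rpow_neg (show 0 < 1 / 2 + δ by positivity)
      filter_upwards [h.eventually_le_const (show (0 : ℝ) < 1 / 2 by norm_num),
        eventually_ge_atTop 1] with n h1 hn
      have hnR : (0 : ℝ) < n := by exact_mod_cast hn
      have h2 : (n : ℝ) = (n : ℝ) ^ (3 / 2 + δ) * (n : ℝ) ^ (-(1 / 2 + δ)) := by
        rw [← Real.rpow_add hnR]
        norm_num
      have h3 := mul_le_mul_of_nonneg_left h1
        (show 0 ≤ (n : ℝ) ^ (3 / 2 + δ) by positivity)
      linarith
    have hupper : Tendsto (fun n : ℕ =>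
        1 - Real.exp (-(n : ℝ) ^ (-(δ / 2)) - 2 * (n : ℝ) ^ (-(2 * δ))) *
          (1 - P.real (bad (k n))) + (n : ℝ) ^ (-δ)) atTop (nhds 0) := by
      have h1 := (Real.continuous_exp.tendsto _).comp (hlim1.neg.sub (hlim2.const_mul 2))
      have h2 := (hlln.comp hktop).const_sub 1
      have h3 := ((h1.mul h2).const_sub 1).add hlim3
      simpa using h3
    refine squeeze_zero' (Eventually.of_forall fun n => tv_nonneg _ _ _) ?_ hupper
    filter_upwards [hprob, h2n, eventually_ge_atTop 1] with n h1 h2 hn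
    rw [hmix n hn]
    refine (tv_integral_Qs_le hn (hM _) (hMpos _) h2).trans ?_
    gcongr
  · intro k hk
    set K : ℕ → ℕ := fun n => ⌊(1 - ε) * (3 / (2 * μ)) * Real.log n⌋₊ with hK
    have hC : 0 < (1 - ε) * (3 / (2 * μ)) := mul_pos (by linarith) (by positivity)
    have hKtop : Tendsto K atTop atTop :=
      tendsto_nat_floor_atTop.comp (hlogtop.const_mul_atTop hC)
    have hprob : ∀ᶠ n : ℕ in atTop,
        P.real {ω | (n : ℝ) ^ (3 / 2 - δ) < (∏ i ∈ Finset.range (k n), X i ω : ℕ)} ≤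
          P.real (bad (K n)) := by
      filter_upwards [eventually_ge_atTop 2, hKtop.eventually_gt_atTop 0] with n hn hKn
      refine ENNReal.toReal_mono (measure_ne_top _ _) (measure_mono_ae ?_)
      filter_upwards [hlog (k n), hMpos (k n)] with ω h1 h2 hω
      have hnR : (0 : ℝ) < n := by positivity
      have hL : 0 ≤ Real.log n := Real.log_natCast_nonneg n
      have hK0 : (0 : ℝ) < K n := by exact_mod_cast hKn
      have hKle : (K n : ℝ) ≤ (1 - ε) * (3 / (2 * μ)) * Real.log n :=
        Nat.floor_le (by positivity)
      change (n : ℝ) ^ (3 / 2 - δ) < _ at hω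
      rw [Real.rpow_def_of_pos hnR,
        ← Real.lt_log_iff_exp_lt (by exact_mod_cast h2), h1] at hω
      have h3 : ∑ i ∈ Finset.range (k n), Real.log (X i ω) ≤
          ∑ i ∈ Finset.range (K n), Real.log (X i ω) :=
        Finset.sum_le_sum_of_subset_of_nonneg
          (Finset.range_subset_range.2 (Nat.le_floor (hk n hn).le))
          fun i _ _ => Real.log_natCast_nonneg _
      refine le_trans ?_ (le_abs_self _)
      rw [le_sub_iff_add_le, le_div_iff₀ hK0]
      refine le_trans ?_ (hω.le.trans h3)
      have h5 : 0 < μ * ε / 4 + μ := by positivity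
      refine (mul_le_mul_of_nonneg_left hKle h5.le).trans ?_
      have h6 : (μ * ε / 4 + μ) * ((1 - ε) * (3 / (2 * μ)) * Real.log n) =
          Real.log n * (3 / 2 * ((1 - ε) * (1 + ε / 4))) := by
        field_simp
        ring
      rw [h6]
      refine mul_le_mul_of_nonneg_left ?_ hL
      rw [hδ]
      nlinarith
    have hlarge : ∀ᶠ n : ℕ in atTop, 2 * (n : ℝ) ^ (-(δ / 2)) + (n : ℝ) ^ (-(1 - δ)) +
        (n : ℝ) ^ (-2 : ℝ) ≤ 1 / 24 := by
      have h1 := tendsto_natCast_rpow_neg (show 0 < 1 - δ by rw [hδ]; linarith)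
      have h2 := ((hlim1.const_mul 2).add h1).add (tendsto_natCast_rpow_neg two_pos)
      exact h2.eventually_le_const (by norm_num)
    have hlower : Tendsto (fun n : ℕ => 1 - Real.exp (-(n : ℝ) ^ (2 * δ) / 48) -
        P.real (bad (K n)) - (n : ℝ) ^ (-δ)) atTop (nhds 1) := by
      have h0 : Tendsto (fun n : ℕ => (n : ℝ) ^ (2 * δ)) atTop atTop :=
        (tendsto_rpow_atTop (by positivity)).comp tendsto_natCast_atTop_atTop
      have h1 := Real.tendsto_exp_atBot.comp
        ((tendsto_neg_atTop_atBot.comp h0).atBot_div_const (show (0 : ℝ) < 48 by norm_num))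
      have h2 := ((h1.const_sub 1).sub (hlln.comp hKtop)).sub hlim3
      simpa using h2
    refine tendsto_of_tendsto_of_tendsto_of_le_of_le' hlower tendsto_const_nhds ?_ ?_
    · filter_upwards [hprob, hlarge, eventually_ge_atTop 1] with n h1 h2 hn
      rw [hmix n hn]
      refine le_trans ?_ (le_tv_integral_Qs hn (hM _) (hMpos _) h2)
      gcongr
    · filter_upwards [eventually_ge_atTop 1] with n hn
      rw [hmix n hn]
      exact tv_Us_le_one (fun σ => integral_nonneg fun ω => Qs_nonneg _ _ σ)
        (sum_integral_Qs hn (hM _) (hMpos _))
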